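/- The function f_sat is globally Lipschitz on ℝ with Lipschitz constant L_sat = (3√3/8)·α/√κ; that is, |f_sat(v) − f_sat(v')| ≤ L_sat·|v − v'| for all v, v' ∈ ℝ. -/

import Mathlib

lemma fsat_aux (x y r : ℝ) (hr : 0 < r) (hr2 : r ^ 2 = 3) :
    x + y ≤ (3 * r / 8) * ((1 + x ^ 2) * (1 + y ^ 2)) := by
  have hr1 : 1.7 < r := by nlinarith
  obtain ⟨t, ht⟩ : ∃ t, t = (x + y) / 2 := ⟨_, rfl⟩
  have hs : x + y = 2 * t := by linarith
  have hp : x * y ≤ t ^ 2 := by rw [ht]; nlinarith [sq_nonneg (x - y)]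
  have hE : (1 + x ^ 2) * (1 + y ^ 2) = 4 * t ^ 2 + (1 - x * y) ^ 2 := by
    rw [ht]; ring
  rw [hs, hE]
  rcases le_or_gt t 0 with h0 | h0
  · have : 0 ≤ (3 * r / 8) * (4 * t ^ 2 + (1 - x * y) ^ 2) := by positivity
    linarith
  rcases le_or_gt t 1 with h | h
  · have h1 : (1 + t ^ 2) ^ 2 ≤ 4 * t ^ 2 + (1 - x * y) ^ 2 := by
      have : t ^ 2 ≤ 1 := by nlinarith
      nlinarith
    have h2 : 2 / 3 + 2 * t * r / 3 ≤ 1 + t ^ 2 := by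
      nlinarith [sq_nonneg (t - r / 3)]
    have h3 : 4 * (2 / 3) * (2 * t * r / 3) ≤ (1 + t ^ 2) ^ 2 := by
      have h4 : (2 / 3 + 2 * t * r / 3) ^ 2 ≤ (1 + t ^ 2) ^ 2 := by gcongr
      nlinarith [sq_nonneg (2 / 3 - 2 * t * r / 3)]
    calc 2 * t = (3 * r / 8) * (4 * (2 / 3) * (2 * t * r / 3)) := by
          linear_combination (-2 * t / 3) * hr2
      _ ≤ _ := by gcongr; linarith
  · have h5 : (3 * r / 8) * (4 * t ^ 2) ≤ (3 * r / 8) * (4 * t ^ 2 + (1 - x * y) ^ 2) := by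
      gcongr; nlinarith [sq_nonneg (1 - x * y)]
    have h6 : t ≤ t ^ 2 := by nlinarith
    nlinarith [mul_pos hr (pow_pos h0 2), mul_pos (sub_pos.2 hr1) (pow_pos h0 2)]

/-- `f_sat` is globally Lipschitz on `ℝ` with constant
`L_sat = (3√3/8)·α/√κ`. -/
theorem fsat_lipschitz (α κ : ℝ) (hα : 0 < α) (hκ : 0 < κ) :
    ∀ v v' : ℝ,
      |α * v ^ 2 / (1 + κ * v ^ 2) - α * v' ^ 2 / (1 + κ * v' ^ 2)|
        ≤ (3 * Real.sqrt 3 / 8) * α / Real.sqrt κ * |v - v'| := by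
  intro v w
  have hr : 0 < Real.sqrt 3 := by positivity
  have hr2 : Real.sqrt 3 ^ 2 = 3 := Real.sq_sqrt (by norm_num)
  have hk : 0 < Real.sqrt κ := by positivity
  have hk2 : Real.sqrt κ ^ 2 = κ := Real.sq_sqrt hκ.le
  generalize Real.sqrt 3 = r at *
  generalize Real.sqrt κ = k at *
  subst hk2
  have hD : 0 < (1 + k ^ 2 * v ^ 2) * (1 + k ^ 2 * w ^ 2) := by positivity
  have e : α * v ^ 2 / (1 + k ^ 2 * v ^ 2) - α * w ^ 2 / (1 + k ^ 2 * w ^ 2)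
      = α * ((v + w) / ((1 + k ^ 2 * v ^ 2) * (1 + k ^ 2 * w ^ 2))) * (v - w) := by
    have h1 : 1 + k ^ 2 * v ^ 2 ≠ 0 := by positivity
    have h2 : 1 + k ^ 2 * w ^ 2 ≠ 0 := by positivity
    field_simp
    ring
  rw [e, abs_mul, abs_mul, abs_of_pos hα, abs_div, abs_of_pos hD]
  have key : |v + w| / ((1 + k ^ 2 * v ^ 2) * (1 + k ^ 2 * w ^ 2)) ≤ 3 * r / 8 / k := by
    rw [div_le_div_iff₀ hD hk]
    have h1 := fsat_aux (k * v) (k * w) r hr hr2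
    have h2 := fsat_aux (-(k * v)) (-(k * w)) r hr hr2
    rw [← abs_of_pos hk, ← abs_mul, abs_of_pos hk]
    apply abs_le.2
    constructor <;> nlinarith
  calc _ ≤ α * (3 * r / 8 / k) * |v - w| := by gcongr
    _ = _ := by ring
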